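/- For every real constant X_c > 0, the function f(Δ) = √(1 − e^{−2Δ/X_c}) / Δ is strictly decreasing on (0, ∞). (Consequently the Greedy algorithm's expected total traversed distance bound E[D], which is a positive constant multiple of f(Δ), is a strictly decreasing function of the step size Δ > 0, and no local minimum of E[D] exists for Δ > 0.) -/

import Mathlib

/-- The chord slope of `t ↦ 1 - exp (-t / k)` from the origin is strictly decreasing. -/
theorem mul_one_sub_exp_lt {k a b : ℝ} (hk : 0 < k) (ha : 0 < a) (hab : a < b) :
    a * (1 - Real.exp (-(2 * b) / k)) < b * (1 - Real.exp (-(2 * a) / k)) := by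
  have hb : 0 < b := ha.trans hab
  have hne : -(2 * b) / k ≠ 0 := div_ne_zero (by linarith) hk.ne'
  have h := strictConvexOn_exp.2 (Set.mem_univ (-(2 * b) / k)) (Set.mem_univ 0) hne
    (div_pos ha hb) (sub_pos.2 ((div_lt_one hb).2 hab)) (by ring)
  have hcomb : (a / b) • (-(2 * b) / k) + (1 - a / b) • (0 : ℝ) = -(2 * a) / k := by
    simp only [smul_eq_mul]
    field_simp
    ring
  rw [hcomb, Real.exp_zero, smul_eq_mul, smul_eq_mul] at h
  have h' := mul_lt_mul_of_pos_left h hb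
  have hexpand : b * (a / b * Real.exp (-(2 * b) / k) + (1 - a / b) * 1) =
      a * Real.exp (-(2 * b) / k) + (b - a) := by
    field_simp
  linarith

/-- For every real constant `X_c > 0`, the function
`f(Δ) = √(1 − e^{−2Δ/X_c}) / Δ` is strictly decreasing on `(0, ∞)`. -/
theorem greedy_bound_strictAntiOn (Xc : ℝ) (hXc : 0 < Xc) :
    StrictAntiOn (fun Δ : ℝ => Real.sqrt (1 - Real.exp (-(2 * Δ) / Xc)) / Δ)
      (Set.Ioi (0 : ℝ)) := by
  intro a (ha : 0 < a) b (hb : 0 < b) hab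
  have hpos : ∀ t : ℝ, 0 < t → 0 < 1 - Real.exp (-(2 * t) / Xc) := fun t ht =>
    sub_pos.2 (Real.exp_lt_one_iff.2 (div_neg_of_neg_of_pos (by linarith) hXc))
  have hga := hpos a ha
  have hgb := hpos b hb
  have h := mul_one_sub_exp_lt hXc ha hab
  dsimp only
  rw [div_lt_div_iff₀ hb ha]
  refine lt_of_pow_lt_pow_left₀ 2 (by positivity) ?_
  rw [mul_pow, mul_pow, Real.sq_sqrt hga.le, Real.sq_sqrt hgb.le]
  nlinarith [mul_lt_mul_of_pos_left h ha, mul_lt_mul_of_pos_right hab (mul_pos hb hga)]
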